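/- arXiv:1612.05514 — 3 statements merged into one kernel-verified Lean document; each statement's English description precedes it below -/
import Mathlib

section
/- Let M be a Maya diagram with −1 ∉ M and let M' = M + 1. Let (s₁,…,s_p | t₁,…,t_q) be the Frobenius symbol of M (so that s_p = 0). Then the Hermite pseudo-Wronskians satisfy H_M = (−1)^{p+q−1} · 2^{p−1} · (∏_{a=1}^{p−1} s_a) · H_{M'} as functions on ℝ. -/
/-- A Maya diagram: a set of integers containing only finitely many non-negative
integers and excluding only finitely many negative integers. -/
def IsMaya (M : Set ℤ) : Prop :=
  {m : ℤ | m ∈ M ∧ 0 ≤ m}.Finite ∧ {m : ℤ | m < 0 ∧ m ∉ M}.Finite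

/-- The shifted Maya diagram `M - k = {m - k : m ∈ M}`. -/
def shiftM (M : Set ℤ) (k : ℤ) : Set ℤ := {m : ℤ | m + k ∈ M}

/-- `M₊`, viewed as a subset of ℕ. -/
def MayaPlus (M : Set ℤ) : Set ℕ := {a : ℕ | (a : ℤ) ∈ M}

/-- `M₋ = {-m-1 : m < 0, m ∉ M}`, viewed as a subset of ℕ. -/
def MayaMinus (M : Set ℤ) : Set ℕ := {a : ℕ | (-(a : ℤ) - 1) ∉ M}

/-- The girth `|M| = #M₋ + #M₊`. -/
noncomputable def girth (M : Set ℤ) : ℕ := (MayaMinus M).ncard + (MayaPlus M).ncard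

/-- Physicists' Hermite polynomial `H_n(x) = (-1)^n e^{x²} Dⁿ e^{-x²}`, as a real function. -/
noncomputable def physHermite (n : ℕ) : ℝ → ℝ :=
  fun x => (-1 : ℝ) ^ n * Real.exp (x ^ 2) * iteratedDeriv n (fun y => Real.exp (-y ^ 2)) x

/-- The complex Hermite function `(-1)^n e^{z²} Dⁿ e^{-z²}`. -/
noncomputable def hermiteC (n : ℕ) : ℂ → ℂ :=
  fun z => (-1 : ℂ) ^ n * Complex.exp (z ^ 2) * iteratedDeriv n (fun w => Complex.exp (-w ^ 2)) z

/-- Conjugate Hermite polynomial `θ_n(x) = i^{-n} H_n(i x)`, as a real function. -/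
noncomputable def conjHermite (n : ℕ) : ℝ → ℝ :=
  fun x => (Complex.I ^ (-(n : ℤ)) * hermiteC n (Complex.I * x)).re

/-- The Hermite pseudo-Wronskian of a Maya diagram with Frobenius symbol
`(s₁,…,s_p | t₁,…,t_q)`:
`H_M(x) = e^{-p x²} · Wr[e^{x²}θ_{s₁}, …, e^{x²}θ_{s_p}, H_{t_q}, …, H_{t₁}](x)`.
Here `s i` is `s_{i+1}` and `t j` is `t_{j+1}` (0-based indexing). -/
noncomputable def pW (p q : ℕ) (s : Fin p → ℕ) (t : Fin q → ℕ) (x : ℝ) : ℝ :=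
  Real.exp (-(p : ℝ) * x ^ 2) *
    Matrix.det (Matrix.of fun i k : Fin (p + q) =>
      iteratedDeriv (k : ℕ)
        (fun y => if h : (i : ℕ) < p then Real.exp (y ^ 2) * conjHermite (s ⟨i, h⟩) y
          else physHermite (t ⟨p + q - 1 - (i : ℕ), by have := i.isLt; omega⟩) y) x)

/-- `(s₁,…,s_p | t₁,…,t_q)` is the Frobenius symbol of `M`. -/
def IsFrobenius {p q : ℕ} (M : Set ℤ) (s : Fin p → ℕ) (t : Fin q → ℕ) : Prop :=
  StrictAnti s ∧ StrictAnti t ∧ Set.range s = MayaMinus M ∧ Set.range t = MayaPlus M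

/-- `i_n = #{m ∉ M : m < n}`. -/
noncomputable def iN (M : Set ℤ) (n : ℤ) : ℕ := {m : ℤ | m ∉ M ∧ m < n}.ncard

/-- `j_n = #{m ∈ M : m ≥ n}`. -/
noncomputable def jN (M : Set ℤ) (n : ℤ) : ℕ := {m : ℤ | m ∈ M ∧ n ≤ m}.ncard

/-- `M` is in standard form. -/
def IsStandard (M : Set ℤ) : Prop := 0 ∉ M ∧ ∀ m : ℤ, m < 0 → m ∈ M

namespace PW
open Finset

/-- Wronskian determinant. -/
noncomputable def W (n : ℕ) (f : ℕ → ℝ → ℝ) (x : ℝ) : ℝ :=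
  Matrix.det (Matrix.of fun i k : Fin n => iteratedDeriv (k : ℕ) (f i) x)

lemma W_congr {n : ℕ} {f g : ℕ → ℝ → ℝ} (h : ∀ i < n, f i = g i) (x : ℝ) : W n f x = W n g x := by
  unfold W
  congr 1
  ext i k
  simp [h i i.isLt]

lemma W_const_mul (n : ℕ) (c : ℕ → ℝ) (f : ℕ → ℝ → ℝ) (x : ℝ) :
    W n (fun i y => c i * f i y) x = (∏ i ∈ range n, c i) * W n f x := by
  unfold W
  rw [Finset.prod_range, ← Matrix.det_mul_column]
  congr 1
  ext i k
  simp [iteratedDeriv_const_mul_field]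

lemma W_mul (n : ℕ) (g : ℝ → ℝ) (hg : ContDiff ℝ ⊤ g) (f : ℕ → ℝ → ℝ)
    (hf : ∀ i < n, ContDiff ℝ (⊤ : ℕ∞) (f i)) (x : ℝ) :
    W n (fun i y => g y * f i y) x = g x ^ n * W n f x := by
  have key : (Matrix.of fun i k : Fin n => iteratedDeriv (k : ℕ) (fun y => g y * f i y) x) =
      (Matrix.of fun i k : Fin n => iteratedDeriv (k : ℕ) (f i) x) *
      (Matrix.of fun j k : Fin n => if (j : ℕ) ≤ k then
        (Nat.choose k j : ℝ) * iteratedDeriv ((k : ℕ) - j) g x else 0) := by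
    ext i k
    have h1 : ContDiffAt ℝ (k : ℕ) (f i) x :=
      ((hf i i.isLt).of_le (by exact_mod_cast le_top)).contDiffAt
    have h2 : ContDiffAt ℝ (k : ℕ) g x := (hg.of_le le_top).contDiffAt
    simp only [Matrix.of_apply, Matrix.mul_apply]
    simp_rw [mul_comm (g _)]
    rw [iteratedDeriv_fun_mul h1 h2]
    rw [← Finset.sum_range (fun j => iteratedDeriv j (f i) x * if j ≤ (k : ℕ) then
        (Nat.choose k j : ℝ) * iteratedDeriv ((k : ℕ) - j) g x else 0)]
    rw [← Finset.sum_subset (s₁ := range (k + 1)) (s₂ := range n)]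
    · apply Finset.sum_congr rfl
      intro j hj
      rw [if_pos (by simp at hj; omega)]
      ring
    · intro j hj
      have := k.isLt
      simp at hj ⊢
      omega
    · intro j hj hj'
      rw [if_neg (by simp at hj'; omega), mul_zero]
  unfold W
  rw [key, Matrix.det_mul, mul_comm]
  congr 1
  rw [Matrix.det_of_isUpperTriangular]
  · simp
  · intro i j hij
    simp only [id] at hij
    simp [hij]

lemma W_one (n p : ℕ) (hp : p ≤ n) (f : ℕ → ℝ → ℝ) (h1 : f p = fun _ => 1) (x : ℝ) :
    W (n + 1) f x = (-1) ^ p * W n (fun i => deriv (f (if i < p then i else i + 1))) x := by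
  unfold W
  rw [Matrix.det_succ_row _ (⟨p, by omega⟩ : Fin (n + 1))]
  rw [Fin.sum_univ_succ, Finset.sum_eq_zero]
  · simp only [Matrix.of_apply, h1, iteratedDeriv_const]
    simp only [Fin.val_zero, add_zero, if_true, mul_one]
    congr 2
    ext i k
    simp only [Matrix.submatrix_apply, Matrix.of_apply, Fin.zero_succAbove, Fin.val_succ,
      iteratedDeriv_succ']
    congr 3
    simp only [Fin.succAbove, Fin.lt_def, Fin.val_castSucc]
    split_ifs <;> simp
  · intro j _
    simp [h1, iteratedDeriv_const]

/-! Hermite facts -/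

lemma gauss_rec (n : ℕ) (z : ℂ) : iteratedDeriv (n + 2) (fun w => Complex.exp (-w ^ 2)) z =
    -2 * z * iteratedDeriv (n + 1) (fun w => Complex.exp (-w ^ 2)) z
      - 2 * (n + 1) * iteratedDeriv n (fun w => Complex.exp (-w ^ 2)) z := by
  have hs : ContDiff ℂ ⊤ (fun w => Complex.exp (-w ^ 2)) := by fun_prop
  have hd : ∀ n z, HasDerivAt (iteratedDeriv n (fun w => Complex.exp (-w ^ 2)))
      (iteratedDeriv (n + 1) (fun w => Complex.exp (-w ^ 2)) z) z := by
    intro n z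
    rw [iteratedDeriv_succ]
    exact ((hs.differentiable_iteratedDeriv n (WithTop.coe_lt_top _)) z).hasDerivAt
  have h1 : ∀ z, iteratedDeriv 1 (fun w => Complex.exp (-w ^ 2)) z
      = -2 * z * Complex.exp (-z ^ 2) := by
    intro z
    rw [iteratedDeriv_one]
    have := ((hasDerivAt_pow 2 z).neg).cexp
    refine (this.congr_deriv ?_).deriv
    simp; ring
  induction n generalizing z with
  | zero =>
    have e : HasDerivAt (iteratedDeriv 1 (fun w => Complex.exp (-w ^ 2))) _ z := hd 1 z
    have e2 : HasDerivAt (fun z => -2 * z * Complex.exp (-z ^ 2)) _ z :=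
      ((hasDerivAt_id z).const_mul (-2)).mul (hd 0 z)
    rw [show iteratedDeriv 1 (fun w => Complex.exp (-w ^ 2)) =
      (fun z => -2 * z * Complex.exp (-z ^ 2)) from funext h1] at e
    have := e.unique e2
    simp only [zero_add, iteratedDeriv_zero, id] at this ⊢
    rw [this]; push_cast; ring
  | succ n ih =>
    have e := hd (n + 2) z
    have e2 := (((hasDerivAt_id z).const_mul (-2)).mul (hd (n + 1) z)).sub
      ((hd n z).const_mul (2 * ((n : ℂ) + 1)))
    rw [show iteratedDeriv (n + 2) (fun w => Complex.exp (-w ^ 2)) = _ from funext ih] at e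
    have := e.unique e2
    simp only [id] at this
    rw [this]; push_cast; ring

lemma hermiteC_deriv (n : ℕ) (z : ℂ) :
    HasDerivAt (hermiteC (n + 1)) (2 * (n + 1) * hermiteC n z) z := by
  have hs : ContDiff ℂ ⊤ (fun w => Complex.exp (-w ^ 2)) := by fun_prop
  have hd : HasDerivAt (iteratedDeriv (n + 1) (fun w => Complex.exp (-w ^ 2)))
      (iteratedDeriv (n + 2) (fun w => Complex.exp (-w ^ 2)) z) z := by
    rw [iteratedDeriv_succ (n := n + 1)]
    exact ((hs.differentiable_iteratedDeriv (n + 1) (WithTop.coe_lt_top _)) z).hasDerivAt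
  have := (((hasDerivAt_pow 2 z).cexp).const_mul ((-1) ^ (n + 1))).mul hd
  refine this.congr_deriv ?_
  rw [gauss_rec, hermiteC]
  push_cast
  simp only [pow_succ]
  ring

lemma conj_deriv (n : ℕ) (x : ℝ) :
    HasDerivAt (conjHermite (n + 1)) (2 * (n + 1) * conjHermite n x) x := by
  have h0 : HasDerivAt (fun w : ℂ => Complex.I * w) (Complex.I * 1) (x : ℂ) :=
    (hasDerivAt_id (x : ℂ)).const_mul Complex.I
  have h := ((hermiteC_deriv n (Complex.I * x)).comp (x : ℂ) h0).const_mul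
    (Complex.I ^ (-((n + 1 : ℕ) : ℤ)))
  have h2 := Complex.reCLM.hasFDerivAt.comp_hasDerivAt x h.comp_ofReal
  refine h2.congr_deriv ?_
  simp only [Complex.reCLM_apply, conjHermite]
  have : Complex.I ^ (-((n + 1 : ℕ) : ℤ)) * Complex.I = Complex.I ^ (-(n : ℤ)) := by
    rw [← zpow_add_one₀ Complex.I_ne_zero]
    congr 1; push_cast; ring
  rw [← this, ← Complex.re_ofReal_mul]
  congr 1
  push_cast
  ring

lemma conj_zero : conjHermite 0 = fun _ => 1 := by
  ext x
  simp only [conjHermite, hermiteC, iteratedDeriv_zero]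
  simp [← Complex.exp_add]

lemma conj_smooth (n : ℕ) : ContDiff ℝ (⊤ : ℕ∞) (conjHermite n) := by
  induction n with
  | zero => rw [conj_zero]; exact contDiff_const
  | succ n ih =>
    rw [contDiff_infty_iff_deriv]
    refine ⟨fun x => (conj_deriv n x).differentiableAt, ?_⟩
    rw [show deriv (conjHermite (n + 1)) = _ from funext fun x => (conj_deriv n x).deriv]
    exact contDiff_const.mul ih

lemma gaussR_smooth : ContDiff ℝ ⊤ (fun y : ℝ => Real.exp (-y ^ 2)) := by fun_prop

lemma phys_eq (n : ℕ) (x : ℝ) : Real.exp (-x ^ 2) * physHermite n x =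
    (-1) ^ n * iteratedDeriv n (fun y : ℝ => Real.exp (-y ^ 2)) x := by
  have : Real.exp (-x ^ 2) * Real.exp (x ^ 2) = 1 := by rw [← Real.exp_add]; simp
  unfold physHermite
  linear_combination (-1) ^ n * iteratedDeriv n (fun y : ℝ => Real.exp (-y ^ 2)) x * this

lemma phys_deriv (n : ℕ) : deriv (fun x => Real.exp (-x ^ 2) * physHermite n x) =
    fun x => (-1) * (Real.exp (-x ^ 2) * physHermite (n + 1) x) := by
  ext x
  simp_rw [phys_eq]
  rw [iteratedDeriv_succ, deriv_const_mul_field]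
  ring

lemma phys_smooth (n : ℕ) : ContDiff ℝ (⊤ : ℕ∞) (physHermite n) := by
  unfold physHermite
  have : ContDiff ℝ (⊤ : ℕ∞) (iteratedDeriv n (fun y : ℝ => Real.exp (-y ^ 2))) := by
    rw [iteratedDeriv_eq_iterate]
    exact ContDiff.iterate_deriv n (gaussR_smooth.of_le le_top)
  fun_prop

/-! Assembly -/

/-- The rows of the pseudo-Wronskian. -/
noncomputable def F (p q : ℕ) (S T : ℕ → ℕ) (i : ℕ) (y : ℝ) : ℝ :=
  if i < p then Real.exp (y ^ 2) * conjHermite (S i) y else physHermite (T (p + q - 1 - i)) y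

lemma F_smooth (p q : ℕ) (S T : ℕ → ℕ) (i : ℕ) : ContDiff ℝ (⊤ : ℕ∞) (F p q S T i) := by
  unfold F
  have h1 := conj_smooth (S i)
  have h2 := phys_smooth (T (p + q - 1 - i))
  split_ifs <;> fun_prop

/-- Extension by zero. -/
def ext0 {p : ℕ} (s : Fin p → ℕ) (i : ℕ) : ℕ := if h : i < p then s ⟨i, h⟩ else 0

lemma pW_eq (p q : ℕ) (s : Fin p → ℕ) (t : Fin q → ℕ) (x : ℝ) :
    pW p q s t x = Real.exp (-(p : ℝ) * x ^ 2) * W (p + q) (F p q (ext0 s) (ext0 t)) x := by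
  unfold pW W
  congr 3
  ext i k
  congr 1
  ext y
  have := i.isLt
  unfold F ext0
  by_cases h : (i : ℕ) < p
  · simp [h]
  · rw [dif_neg h, if_neg h, dif_pos (by omega)]

lemma shift_core (p q : ℕ) (S T S' T' : ℕ → ℕ) (h0 : S p = 0) (hS : ∀ i < p, S i = S' i + 1)
    (hT : ∀ j < q, T' j = T j + 1) (x : ℝ) :
    Real.exp (-((p + 1 : ℕ) : ℝ) * x ^ 2) * W (p + 1 + q) (F (p + 1) q S T) x =
      (-1) ^ (p + q) * 2 ^ p * (∏ a ∈ range p, (S a : ℝ)) *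
        (Real.exp (-(p : ℝ) * x ^ 2) * W (p + q) (F p q S' T') x) := by
  have hE : ∀ y : ℝ, Real.exp (-y ^ 2) * Real.exp (y ^ 2) = 1 := fun y => by
    rw [← Real.exp_add]; simp
  have a1 := W_mul (p + q + 1) _ gaussR_smooth (F (p + 1) q S T)
    (fun i _ => F_smooth _ _ _ _ i) x
  have a2 := W_mul (p + q) _ gaussR_smooth (F p q S' T') (fun i _ => F_smooth _ _ _ _ i) x
  have a3 := W_one (p + q) p (by omega)
    (fun i y => Real.exp (-y ^ 2) * F (p + 1) q S T i y) (by
      ext y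
      simp only [F, lt_add_one, if_true, h0, conj_zero, mul_one, hE]) x
  have a4 := W_congr (n := p + q)
    (f := (fun i => deriv ((fun i y => Real.exp (-y ^ 2) * F (p + 1) q S T i y)
      (if i < p then i else i + 1))))
    (g := fun i y => (fun i => if i < p then 2 * (S i : ℝ) else -1) i *
      (fun i y => Real.exp (-y ^ 2) * F p q S' T' i y) i y) (by
      intro i hi
      by_cases h : i < p
      · simp only [h, if_true, F, show i < p + 1 by omega, ← mul_assoc, hE, one_mul]
        ext y
        rw [hS i h, show (fun y => conjHermite (S' i + 1) y) = conjHermite (S' i + 1) from rfl,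
          (conj_deriv _ _).deriv]
        push_cast; ring
      · simp only [h, if_false, F, show ¬ (i + 1 < p + 1) by omega]
        rw [phys_deriv, hT _ (by omega),
          show p + 1 + q - 1 - (i + 1) = p + q - 1 - i by omega]) x
  rw [W_const_mul] at a4
  have a5 : (∏ i ∈ range (p + q), (if i < p then 2 * (S i : ℝ) else -1)) =
      2 ^ p * (∏ a ∈ range p, (S a : ℝ)) * (-1) ^ q := by
    rw [Finset.prod_range_add]
    congr 1
    · rw [Finset.prod_congr rfl (g := fun i => 2 * (S i : ℝ))]
      · simp [Finset.prod_mul_distrib]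
      · intro i hi
        simp at hi
        simp [hi]
    · simp
  rw [a3, a4, a2, a5] at a1
  rw [show p + 1 + q = p + q + 1 by omega]
  have e1 : Real.exp (-((p + 1 : ℕ) : ℝ) * x ^ 2) =
      Real.exp (-(p : ℝ) * x ^ 2) * Real.exp (-x ^ 2) := by
    rw [← Real.exp_add]; congr 1; push_cast; ring
  rw [e1]
  have hne : Real.exp (-x ^ 2) ^ (p + q) ≠ 0 := by positivity
  apply mul_left_cancel₀ hne
  rw [pow_add (-1 : ℝ)]
  linear_combination (- Real.exp (-(p : ℝ) * x ^ 2)) * a1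

lemma anti_unique {n m : ℕ} (f : Fin n → ℕ) (g : Fin m → ℕ) (hf : StrictAnti f)
    (hg : StrictAnti g) (h : Set.range f = Set.range g) : n = m ∧ ext0 f = ext0 g := by
  have hc : n = m := by
    have := Set.ncard_range_of_injective hf.injective
    rw [h, Set.ncard_range_of_injective hg.injective] at this
    simpa using this.symm
  subst hc
  refine ⟨rfl, ?_⟩
  congr 1
  have e1 := hf.dual_right
  have e2 := hg.dual_right
  have := (StrictMono.range_inj e1 e2).1 (by rw [Set.range_comp, Set.range_comp, h])
  ext i
  exact congrArg OrderDual.ofDual (congrFun this i)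

end PW

/-- Lemma `shift2`. If `−1 ∉ M` and `M' = M + 1`, then
`H_M = (−1)^{p+q−1} 2^{p−1} (∏_{a=1}^{p−1} s_a) H_{M'}`. -/
theorem pseudoWronskian_shift_up (M : Set ℤ) (hM : IsMaya M) (h1 : (-1 : ℤ) ∉ M)
    {p q p' q' : ℕ} (s : Fin p → ℕ) (t : Fin q → ℕ)
    (s' : Fin p' → ℕ) (t' : Fin q' → ℕ)
    (hf : IsFrobenius M s t) (hf' : IsFrobenius (shiftM M (-1)) s' t') :
    ∀ x : ℝ,
      pW p q s t x =
        (-1 : ℝ) ^ (p + q - 1) * 2 ^ (p - 1) *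
          (∏ a : Fin (p - 1), (s (Fin.castLE (Nat.sub_le p 1) a) : ℝ)) *
          pW p' q' s' t' x := by
  obtain ⟨hs, ht, rs, rt⟩ := hf
  obtain ⟨hs', ht', rs', rt'⟩ := hf'
  have A := PW.anti_unique s (Fin.snoc (α := fun _ => ℕ) (fun i => s' i + 1) 0) hs (by
      intro a b hab
      induction b using Fin.lastCases with
      | last =>
        induction a using Fin.lastCases with
        | last => exact absurd hab (lt_irrefl _)
        | cast a => simp
      | cast b =>
        induction a using Fin.lastCases with
        | last => exact absurd hab (not_lt.2 (Fin.le_last _))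
        | cast a => simpa using hs' (by simpa using hab)) (by
      rw [Fin.range_snoc, rs]
      ext a
      rw [Set.mem_insert_iff]
      cases a with
      | zero => simpa [MayaMinus] using h1
      | succ a =>
        have : a ∈ Set.range s' ↔ a ∈ MayaMinus (shiftM M (-1)) := by rw [rs']
        have e : (∃ i, s' i + 1 = a + 1) ↔ a ∈ Set.range s' := by simp
        simp only [Set.mem_range, e, this, MayaMinus, shiftM, Set.mem_ofPred_eq]
        simp only [Nat.add_eq_zero_iff, one_ne_zero, and_false, false_or]
        rw [show -((a + 1 : ℕ) : ℤ) - 1 = -(a : ℤ) - 1 + -1 by push_cast; ring])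
  have B := PW.anti_unique t' (fun j => t j + 1) ht' (fun a b hab => by
      have := ht hab
      simpa using this) (by
      rw [rt']
      ext a
      cases a with
      | zero => simpa [MayaPlus, shiftM] using h1
      | succ a =>
        have : a ∈ Set.range t ↔ a ∈ MayaPlus M := by rw [rt]
        have e : (∃ i, t i + 1 = a + 1) ↔ a ∈ Set.range t := by simp
        simp only [Set.mem_range, e, this, MayaPlus, shiftM, Set.mem_ofPred_eq]
        rw [show ((a + 1 : ℕ) : ℤ) + -1 = (a : ℤ) by push_cast; ring])
  obtain ⟨hp, hS⟩ := A
  obtain ⟨hq, hT⟩ := B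
  subst hp
  subst hq
  intro x
  rw [PW.pW_eq, PW.pW_eq]
  have e := PW.shift_core p' q' (PW.ext0 s) (PW.ext0 t) (PW.ext0 s') (PW.ext0 t')
    (by rw [hS]; simp [PW.ext0, Fin.snoc])
    (by
      intro i hi
      rw [hS]
      simp [PW.ext0, Fin.snoc, hi, show i < p' + 1 by omega])
    (by
      intro j hj
      rw [hT]
      simp [PW.ext0, hj]) x
  rw [e, Finset.prod_range]
  have e3 : ∀ a : Fin p', (PW.ext0 s a : ℝ) =
      (s (Fin.castLE (Nat.sub_le (p' + 1) 1) a) : ℝ) := by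
    intro a
    have := a.isLt
    unfold PW.ext0
    rw [dif_pos (by omega)]
    rfl
  rw [Finset.prod_congr rfl (fun a _ => e3 a)]
  rw [show p' + 1 + q' - 1 = p' + q' by omega]
  rfl
end

section
/- Let M be a Maya diagram and let m₁ > m₂ > ⋯ > m_ℓ > 0 be the positive elements of the unique standard-form representative of M (i.e. of M − min(ℤ \ M)). Then there exists a nonzero real constant c such that the Hermite pseudo-Wronskian satisfies H_M = c · Wr[H_{m_ℓ}, …, H_{m₁}] as functions on ℝ; that is, every Hermite pseudo-Wronskian is a nonzero scalar multiple of a Wronskian of Hermite polynomials with distinct positive indices. -/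
namespace PWProof

open Polynomial

/-- Common recursion for Hermite (`e = -1`) and conjugate Hermite (`e = 1`) polynomials. -/
noncomputable def pe {R : Type*} [CommRing R] (e : R) : ℕ → R[X]
  | 0 => 1
  | n + 1 => 2 * X * pe e n + C e * derivative (pe e n)

theorem derivative_pe {R : Type*} [CommRing R] (e : R) (n : ℕ) :
    derivative (pe e (n + 1)) = C (2 * ((n : R) + 1)) * pe e n := by
  induction n with
  | zero => simp [pe, ← map_ofNat (C : R →+* R[X]) 2]
  | succ n ih =>
    have h1 : pe e (n + 2) = 2 * X * pe e (n + 1) + C e * derivative (pe e (n + 1)) := rfl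
    have h2 : pe e (n + 1) = 2 * X * pe e n + C e * derivative (pe e n) := rfl
    rw [h1, derivative_add, derivative_mul, derivative_mul (f := C e), ih]
    simp only [derivative_mul, derivative_C, derivative_X, derivative_ofNat, zero_mul, mul_zero,
      zero_add, add_zero]
    simp only [map_mul, map_add, map_one, map_natCast, map_ofNat, Nat.cast_add, Nat.cast_one]
    linear_combination (-2 * (n + 1) : R[X]) * h2

theorem iterDeriv_real (n : ℕ) : iteratedDeriv n (fun y : ℝ => Real.exp (-y ^ 2)) =
    fun x => (-1 : ℝ) ^ n * (pe (-1 : ℝ) n).eval x * Real.exp (-x ^ 2) := by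
  induction n with
  | zero => ext x; simp [pe]
  | succ n ih =>
    rw [iteratedDeriv_succ, ih]
    ext x
    have h1 : HasDerivAt (fun x : ℝ => Real.exp (-x ^ 2)) (Real.exp (-x ^ 2) * (-(2 * x))) x := by
      have := ((hasDerivAt_pow 2 x).neg).exp
      simpa using this
    have h2 := (((pe (-1 : ℝ) n).hasDerivAt x).const_mul ((-1 : ℝ) ^ n)).mul h1
    refine h2.deriv.trans ?_
    simp only [pe, eval_add, eval_mul, eval_X, eval_ofNat, eval_C]
    ring

theorem iterDeriv_complex (n : ℕ) : iteratedDeriv n (fun y : ℂ => Complex.exp (-y ^ 2)) =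
    fun x => (-1 : ℂ) ^ n * (pe (-1 : ℂ) n).eval x * Complex.exp (-x ^ 2) := by
  induction n with
  | zero => ext x; simp [pe]
  | succ n ih =>
    rw [iteratedDeriv_succ, ih]
    ext x
    have h1 : HasDerivAt (fun x : ℂ => Complex.exp (-x ^ 2))
        (Complex.exp (-x ^ 2) * (-(2 * x))) x := by
      have := ((hasDerivAt_pow 2 x).neg).cexp
      simpa using this
    have h2 := (((pe (-1 : ℂ) n).hasDerivAt x).const_mul ((-1 : ℂ) ^ n)).mul h1
    refine h2.deriv.trans ?_
    simp only [pe, eval_add, eval_mul, eval_X, eval_ofNat, eval_C]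
    ring

theorem physHermite_eq (n : ℕ) : physHermite n = fun x => (pe (-1 : ℝ) n).eval x := by
  ext x
  simp only [physHermite, iterDeriv_real]
  have h1 : Real.exp (x ^ 2) * Real.exp (-x ^ 2) = 1 := by rw [← Real.exp_add]; simp
  have h2 : (-1 : ℝ) ^ n * (-1 : ℝ) ^ n = 1 := by rw [← mul_pow]; simp
  linear_combination (pe (-1 : ℝ) n).eval x * ((-1 : ℝ) ^ n * (-1 : ℝ) ^ n * h1 + h2)

theorem hermiteC_eq (n : ℕ) : hermiteC n = fun x => (pe (-1 : ℂ) n).eval x := by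
  ext x
  simp only [hermiteC, iterDeriv_complex]
  have h1 : Complex.exp (x ^ 2) * Complex.exp (-x ^ 2) = 1 := by rw [← Complex.exp_add]; simp
  have h2 : (-1 : ℂ) ^ n * (-1 : ℂ) ^ n = 1 := by rw [← mul_pow]; simp
  linear_combination (pe (-1 : ℂ) n).eval x * ((-1 : ℂ) ^ n * (-1 : ℂ) ^ n * h1 + h2)

theorem pe_comp (n : ℕ) : (pe (-1 : ℂ) n).comp (C Complex.I * X) =
    C (Complex.I ^ n) * (pe (1 : ℝ) n).map (algebraMap ℝ ℂ) := by
  induction n with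
  | zero => simp [pe]
  | succ n ih =>
    have hd : C Complex.I * (derivative (pe (-1 : ℂ) n)).comp (C Complex.I * X) =
        C (Complex.I ^ n) * (derivative (pe (1 : ℝ) n)).map (algebraMap ℝ ℂ) := by
      have := congrArg derivative ih
      rw [derivative_comp] at this
      simpa [derivative_map, -map_pow] using this
    have hI : (C Complex.I * C Complex.I : ℂ[X]) = -1 := by
      rw [← C_mul, Complex.I_mul_I]; simp
    have hC : (-1 : ℂ[X]).comp (C Complex.I * X) = -1 := by simp
    simp only [pe, add_comp, mul_comp, hC, ofNat_comp, X_comp, C_comp, ih, Polynomial.map_add,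
      Polynomial.map_mul, Polynomial.map_X, Polynomial.map_ofNat, pow_succ, map_mul, C_comp,
      map_neg, map_one, Polynomial.map_one]
    simp only [map_pow] at hd ⊢
    linear_combination (C Complex.I) * hd
      - (derivative (pe (-1 : ℂ) n)).comp (C Complex.I * X) * hI

theorem conjHermite_eq (n : ℕ) : conjHermite n = fun x => (pe (1 : ℝ) n).eval x := by
  ext x
  have h := congrArg (eval (x : ℂ)) (pe_comp n)
  simp only [eval_comp, eval_mul, eval_C, eval_X] at h
  simp only [conjHermite, hermiteC_eq, h]
  have h3 : (Polynomial.map (algebraMap ℝ ℂ) (pe (1 : ℝ) n)).eval (x : ℂ)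
      = ((pe (1 : ℝ) n).eval x : ℝ) := by
    rw [eval_map]
    exact eval₂_at_apply (algebraMap ℝ ℂ) x
  rw [h3, ← mul_assoc, zpow_neg, zpow_natCast, inv_mul_cancel₀ (pow_ne_zero _ Complex.I_ne_zero)]
  simp

/-! ### Wronskians -/

noncomputable def Wf (n : ℕ) (f : Fin n → ℝ → ℝ) (x : ℝ) : ℝ :=
  Matrix.det (Matrix.of fun i k : Fin n => iteratedDeriv (k : ℕ) (f i) x)

theorem Wf_perm {n : ℕ} (f : Fin n → ℝ → ℝ) (σ : Equiv.Perm (Fin n)) (x : ℝ) :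
    Wf n (f ∘ σ) x = ((Equiv.Perm.sign σ : ℤ) : ℝ) * Wf n f x := by
  exact Matrix.det_permute σ (Matrix.of fun i k : Fin n => iteratedDeriv (k : ℕ) (f i) x)

theorem Wf_smul {n : ℕ} (f : Fin n → ℝ → ℝ) (c : Fin n → ℝ) (x : ℝ) :
    Wf n (fun i y => c i * f i y) x = (∏ i, c i) * Wf n f x := by
  unfold Wf
  rw [← Matrix.det_mul_column]
  congr 1
  ext i k
  simp [iteratedDeriv_const_mul_field]

theorem Wf_cons_one {n : ℕ} (f : Fin (n + 1) → ℝ → ℝ) (h : f 0 = fun _ => 1) (x : ℝ) :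
    Wf (n + 1) f x = Wf n (fun i => deriv (f i.succ)) x := by
  unfold Wf
  rw [Matrix.det_succ_row_zero, Finset.sum_eq_single 0]
  · simp only [Matrix.of_apply, h, Fin.val_zero, pow_zero, iteratedDeriv_zero, one_mul]
    congr 1
    ext i k
    simp [iteratedDeriv_succ']
  · intro b _ hb
    obtain ⟨k, rfl⟩ := Fin.exists_succ_eq.2 hb
    simp [h, iteratedDeriv_succ']
  · simp

theorem Wf_mul {n : ℕ} (f : Fin n → ℝ → ℝ) (g : ℝ → ℝ) (hf : ∀ i, ContDiff ℝ (⊤ : ℕ∞) (f i))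
    (hg : ContDiff ℝ (⊤ : ℕ∞) g) (x : ℝ) :
    Wf n (fun i y => g y * f i y) x = g x ^ n * Wf n f x := by
  unfold Wf
  let U : Matrix (Fin n) (Fin n) ℝ := Matrix.of fun j k : Fin n =>
    ((k : ℕ).choose j : ℝ) * iteratedDeriv ((k : ℕ) - j) g x
  have hU : U.det = g x ^ n := by
    rw [Matrix.det_of_isUpperTriangular]
    · simp [U]
    · intro i j hij
      have : (j : ℕ) < i := hij
      simp [U, Nat.choose_eq_zero_of_lt this]
  rw [← hU, mul_comm, ← Matrix.det_mul]
  congr 1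
  ext i k
  have e : (fun y => g y * f i y) = f i * g := by ext y; simp [mul_comm]
  rw [Matrix.mul_apply]
  change iteratedDeriv (k : ℕ) (fun y => g y * f i y) x = _
  rw [e, iteratedDeriv_mul]
  · simp only [U, Matrix.of_apply]
    rw [Fin.sum_univ_eq_sum_range (fun j => iteratedDeriv j (f i) x *
      (((k : ℕ).choose j : ℝ) * iteratedDeriv ((k : ℕ) - j) g x)) n]
    rw [← Finset.sum_subset (Finset.range_mono (Nat.succ_le_of_lt k.isLt))]
    · refine Finset.sum_congr rfl fun j _ => ?_
      ring
    · intro j _ hj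
      have : (k : ℕ) < j := by simpa using hj
      simp [Nat.choose_eq_zero_of_lt this]
  · exact ((hf i).contDiffAt).of_le (by exact_mod_cast le_top)
  · exact (hg.contDiffAt).of_le (by exact_mod_cast le_top)

noncomputable def phi : ℕ ⊕ ℕ → ℝ → ℝ
  | Sum.inl s => fun y => Real.exp (y ^ 2) * conjHermite s y
  | Sum.inr t => physHermite t

theorem hd_exp (x : ℝ) : HasDerivAt (fun x : ℝ => Real.exp (x ^ 2))
    (Real.exp (x ^ 2) * (2 * x)) x := by
  have := ((hasDerivAt_pow 2 x)).exp
  simpa using this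

theorem hd_exp_neg (x : ℝ) : HasDerivAt (fun x : ℝ => Real.exp (-x ^ 2))
    (Real.exp (-x ^ 2) * (-(2 * x))) x := by
  have := ((hasDerivAt_pow 2 x).neg).exp
  simpa using this

theorem contDiff_poly (P : ℝ[X]) : ContDiff ℝ (⊤ : ℕ∞) (fun x => P.eval x) := by
  simpa [Polynomial.coe_aeval_eq_eval] using P.contDiff_aeval (𝕜 := ℝ) (R := ℝ) (⊤ : ℕ∞)

theorem contDiff_phi (a : ℕ ⊕ ℕ) : ContDiff ℝ (⊤ : ℕ∞) (phi a) := by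
  rcases a with s | t
  · simp only [phi, conjHermite_eq]
    exact (Real.contDiff_exp.comp (contDiff_id.pow 2)).mul (contDiff_poly _)
  · simp only [phi, physHermite_eq]
    exact contDiff_poly _

theorem deriv_phi_inl (s : ℕ) : deriv (phi (Sum.inl s)) = phi (Sum.inl (s + 1)) := by
  ext x
  simp only [phi, conjHermite_eq]
  refine ((hd_exp x).mul ((pe (1 : ℝ) s).hasDerivAt x)).deriv.trans ?_
  simp only [pe, eval_add, eval_mul, eval_X, eval_ofNat, eval_C]
  ring

theorem deriv_phi_inr (t : ℕ) :
    deriv (phi (Sum.inr (t + 1))) = fun x => (2 * ((t : ℝ) + 1)) * phi (Sum.inr t) x := by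
  ext x
  simp only [phi, physHermite_eq]
  rw [Polynomial.deriv, derivative_pe]
  simp

theorem deriv_exp_phi_inl (s : ℕ) :
    deriv (fun y => Real.exp (-y ^ 2) * phi (Sum.inl (s + 1)) y) =
      fun x => (2 * ((s : ℝ) + 1)) * (Real.exp (-x ^ 2) * phi (Sum.inl s) x) := by
  have h1 (x : ℝ) : Real.exp (-x ^ 2) * Real.exp (x ^ 2) = 1 := by rw [← Real.exp_add]; simp
  simp only [phi, conjHermite_eq, ← mul_assoc, h1, one_mul]
  ext x
  rw [Polynomial.deriv, derivative_pe]
  simp [mul_assoc, h1]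

theorem deriv_exp_phi_inr (t : ℕ) :
    deriv (fun y => Real.exp (-y ^ 2) * phi (Sum.inr t) y) =
      fun x => (-1 : ℝ) * (Real.exp (-x ^ 2) * phi (Sum.inr (t + 1)) x) := by
  ext x
  simp only [phi, physHermite_eq]
  refine ((hd_exp_neg x).mul ((pe (-1 : ℝ) t).hasDerivAt x)).deriv.trans ?_
  simp only [pe, eval_add, eval_mul, eval_X, eval_ofNat, eval_C]
  ring

/-! ### Equivalence up to a nonzero scalar -/

def Eqv (f g : ℝ → ℝ) : Prop := ∃ c : ℝ, c ≠ 0 ∧ ∀ x, f x = c * g x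

theorem Eqv.refl (f : ℝ → ℝ) : Eqv f f := ⟨1, one_ne_zero, by simp⟩

theorem Eqv.symm {f g : ℝ → ℝ} (h : Eqv f g) : Eqv g f := by
  obtain ⟨c, hc, h⟩ := h
  exact ⟨c⁻¹, inv_ne_zero hc, fun x => by rw [h]; field_simp⟩

theorem Eqv.trans {f g k : ℝ → ℝ} (h : Eqv f g) (h' : Eqv g k) : Eqv f k := by
  obtain ⟨c, hc, h⟩ := h
  obtain ⟨d, hd, h'⟩ := h'
  exact ⟨c * d, mul_ne_zero hc hd, fun x => by rw [h, h']; ring⟩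

/-- `w` is, up to a nonzero scalar, the pseudo-Wronskian with index sets `S`, `T`. -/
def Rep (S T : Set ℕ) (w : ℝ → ℝ) : Prop :=
  ∃ (n : ℕ) (a : Fin n → ℕ ⊕ ℕ), Function.Injective a ∧
    Set.range a = Sum.inl '' S ∪ Sum.inr '' T ∧
    Eqv w (fun x => Real.exp (-(S.ncard : ℝ) * x ^ 2) * Wf n (fun i => phi (a i)) x)

theorem Rep.of_eqv {S T : Set ℕ} {w w' : ℝ → ℝ} (h : Rep S T w) (e : Eqv w' w) :
    Rep S T w' := by
  obtain ⟨n, a, h1, h2, h3⟩ := h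
  exact ⟨n, a, h1, h2, e.trans h3⟩

theorem Rep.unique {S T : Set ℕ} {w w' : ℝ → ℝ} (h : Rep S T w) (h' : Rep S T w') :
    Eqv w w' := by
  obtain ⟨n, a, h1, h2, h3⟩ := h
  obtain ⟨m, b, h1', h2', h3'⟩ := h'
  have hr : Set.range a = Set.range b := h2.trans h2'.symm
  have hnm : n = m := by
    have := congrArg Set.ncard hr
    rw [← Set.image_univ, ← Set.image_univ, Set.ncard_image_of_injective _ h1,
      Set.ncard_image_of_injective _ h1'] at this
    simpa [Set.ncard_univ] using this
  subst hnm
  let σ : Equiv.Perm (Fin n) :=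
    (Equiv.ofInjective a h1).trans ((Equiv.setCongr hr).trans (Equiv.ofInjective b h1').symm)
  have hσ : ∀ i, b (σ i) = a i := by
    intro i
    have := Equiv.apply_ofInjective_symm h1'
      ((Equiv.setCongr hr) ((Equiv.ofInjective a h1) i))
    simpa [σ] using this
  refine h3.trans (Eqv.trans ?_ h3'.symm)
  refine ⟨((Equiv.Perm.sign σ : ℤ) : ℝ), by simp, fun x => ?_⟩
  have := Wf_perm (fun i => phi (b i)) σ x
  have e : (fun i => phi (b i)) ∘ σ = fun i => phi (a i) := by
    ext i; simp [hσ]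
  rw [e] at this
  dsimp only
  rw [this]; ring

theorem Rep.finite {S T : Set ℕ} {w : ℝ → ℝ} (h : Rep S T w) : S.Finite ∧ T.Finite := by
  obtain ⟨n, a, h1, h2, h3⟩ := h
  have hf : (Sum.inl '' S ∪ Sum.inr '' T : Set (ℕ ⊕ ℕ)).Finite := h2 ▸ Set.finite_range a
  rw [Set.finite_union] at hf
  exact ⟨hf.1.of_finite_image Sum.inl_injective.injOn,
    hf.2.of_finite_image Sum.inr_injective.injOn⟩

theorem exists_rep {S T : Set ℕ} (hS : S.Finite) (hT : T.Finite) : ∃ w, Rep S T w := by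
  have hf : (Sum.inl '' S ∪ Sum.inr '' T : Set (ℕ ⊕ ℕ)).Finite :=
    (hS.image _).union (hT.image _)
  let F := hf.toFinset
  refine ⟨_, F.card, fun i => (F.equivFin.symm i : ℕ ⊕ ℕ), ?_, ?_, Eqv.refl _⟩
  · exact Subtype.val_injective.comp F.equivFin.symm.injective
  · have : (fun i => (F.equivFin.symm i : ℕ ⊕ ℕ)) = Subtype.val ∘ F.equivFin.symm := rfl
    rw [this, Set.range_comp, F.equivFin.symm.surjective.range_eq, Set.image_univ,
      Subtype.range_coe_subtype]
    ext x
    simp [F]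

theorem stepA {S T : Set ℕ} {w : ℝ → ℝ} (h : Rep (Nat.succ '' S) T w) :
    Rep S (insert 0 (Nat.succ '' T)) w := by
  obtain ⟨n, a, h1, h2, h3⟩ := h
  let g : ℕ ⊕ ℕ → ℕ ⊕ ℕ := Sum.map Nat.pred Nat.succ
  have ha : ∀ i, (∃ s ∈ S, a i = Sum.inl (s + 1)) ∨ ∃ t ∈ T, a i = Sum.inr t := by
    intro i
    have : a i ∈ Set.range a := ⟨i, rfl⟩
    rw [h2] at this
    rcases this with ⟨_, ⟨s, hs, rfl⟩, h⟩ | ⟨t, ht, h⟩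
    · exact Or.inl ⟨s, hs, h.symm⟩
    · exact Or.inr ⟨t, ht, h.symm⟩
  refine ⟨n + 1, Fin.cons (Sum.inr 0) (fun i => g (a i)), ?_, ?_, ?_⟩
  · rw [Fin.cons_injective_iff]
    constructor
    · rintro ⟨i, hi⟩
      rcases ha i with ⟨s, _, h⟩ | ⟨t, _, h⟩ <;> simp [h, g] at hi
    · intro i j hij
      apply h1
      rcases ha i with ⟨s, _, h⟩ | ⟨t, _, h⟩ <;> rcases ha j with ⟨s', _, h'⟩ | ⟨t', _, h'⟩ <;>
        simp [h, h', g] at hij ⊢ <;> exact hij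
  · rw [Fin.range_cons]
    have : Set.range (fun i => g (a i)) = g '' Set.range a := by
      rw [← Set.range_comp]; rfl
    rw [this, h2, Set.image_union, Set.image_image, Set.image_image, Set.image_image,
      Set.image_insert_eq, Set.image_image, Set.union_insert]
    simp [g]
  · refine h3.trans (Eqv.symm ?_)
    choose c hc hc' using fun i : Fin n => show ∃ c : ℝ, c ≠ 0 ∧
        deriv (phi (g (a i))) = fun x => c * phi (a i) x by
      rcases ha i with ⟨s, _, h⟩ | ⟨t, _, h⟩
      · refine ⟨1, one_ne_zero, ?_⟩
        simp [h, g, deriv_phi_inl]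
      · refine ⟨2 * ((t : ℝ) + 1), by positivity, ?_⟩
        simp [h, g, deriv_phi_inr]
    refine ⟨∏ i, c i, Finset.prod_ne_zero_iff.2 fun i _ => hc i, fun x => ?_⟩
    dsimp only
    rw [Wf_cons_one]
    · simp only [Fin.cons_succ, hc']
      rw [Wf_smul, Set.ncard_image_of_injective _ Nat.succ_injective]
      ring
    · ext x; simp [phi, physHermite_eq, pe]

theorem stepB {S T : Set ℕ} {w : ℝ → ℝ} (h : Rep S (Nat.succ '' T) w) :
    Rep (insert 0 (Nat.succ '' S)) T w := by
  have hS := h.finite.1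
  obtain ⟨n, a, h1, h2, h3⟩ := h
  let g : ℕ ⊕ ℕ → ℕ ⊕ ℕ := Sum.map Nat.succ Nat.pred
  have ha : ∀ i, (∃ s ∈ S, a i = Sum.inl s) ∨ ∃ t ∈ T, a i = Sum.inr (t + 1) := by
    intro i
    have : a i ∈ Set.range a := ⟨i, rfl⟩
    rw [h2] at this
    rcases this with ⟨s, hs, h⟩ | ⟨_, ⟨t, ht, rfl⟩, h⟩
    · exact Or.inl ⟨s, hs, h.symm⟩
    · exact Or.inr ⟨t, ht, h.symm⟩
  refine ⟨n + 1, Fin.cons (Sum.inl 0) (fun i => g (a i)), ?_, ?_, ?_⟩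
  · rw [Fin.cons_injective_iff]
    constructor
    · rintro ⟨i, hi⟩
      rcases ha i with ⟨s, _, h⟩ | ⟨t, _, h⟩ <;> simp [h, g] at hi
    · intro i j hij
      apply h1
      rcases ha i with ⟨s, _, h⟩ | ⟨t, _, h⟩ <;> rcases ha j with ⟨s', _, h'⟩ | ⟨t', _, h'⟩ <;>
        simp [h, h', g] at hij ⊢ <;> exact hij
  · rw [Fin.range_cons]
    have : Set.range (fun i => g (a i)) = g '' Set.range a := by
      rw [← Set.range_comp]; rfl
    rw [this, h2, Set.image_union, Set.image_image, Set.image_image, Set.image_image,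
      Set.image_insert_eq, Set.image_image, Set.insert_union]
    simp [g]
  · refine h3.trans (Eqv.symm ?_)
    have hE (y : ℝ) : Real.exp (y ^ 2) * Real.exp (-y ^ 2) = 1 := by rw [← Real.exp_add]; simp
    choose c hc hc' using fun i : Fin n => show ∃ c : ℝ, c ≠ 0 ∧
        deriv (fun y => Real.exp (-y ^ 2) * phi (g (a i)) y) =
          fun x => c * (Real.exp (-x ^ 2) * phi (a i) x) by
      rcases ha i with ⟨s, _, h⟩ | ⟨t, _, h⟩
      · refine ⟨2 * ((s : ℝ) + 1), by positivity, ?_⟩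
        simp only [h, g, Sum.map_inl, Nat.succ_eq_add_one, deriv_exp_phi_inl]
      · refine ⟨-1, by simp, ?_⟩
        simp only [h, g, Sum.map_inr, Nat.pred_succ, Nat.pred_eq_sub_one, Nat.add_sub_cancel,
          deriv_exp_phi_inr]
    have cd1 : ContDiff ℝ (⊤ : ℕ∞) (fun y : ℝ => Real.exp (y ^ 2)) :=
      Real.contDiff_exp.comp (contDiff_id.pow 2)
    have cd2 : ContDiff ℝ (⊤ : ℕ∞) (fun y : ℝ => Real.exp (-y ^ 2)) :=
      Real.contDiff_exp.comp (contDiff_id.pow 2).neg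
    refine ⟨∏ i, c i, Finset.prod_ne_zero_iff.2 fun i _ => hc i, fun x => ?_⟩
    have hnc : (insert 0 (Nat.succ '' S) : Set ℕ).ncard = S.ncard + 1 := by
      rw [Set.ncard_insert_of_notMem (by simp) (hS.image _),
        Set.ncard_image_of_injective _ Nat.succ_injective]
    let b : Fin (n + 1) → ℕ ⊕ ℕ := Fin.cons (Sum.inl 0) (fun i => g (a i))
    have e1 : (fun i => phi (b i)) =
        fun i y => Real.exp (y ^ 2) * (Real.exp (-y ^ 2) * phi (b i) y) := by
      ext i y; rw [← mul_assoc, hE, one_mul]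
    have e2 : Wf (n + 1) (fun i => phi (b i)) x =
        Real.exp (x ^ 2) ^ (n + 1) * ((∏ i, c i) * (Real.exp (-x ^ 2) ^ n *
          Wf n (fun i => phi (a i)) x)) := by
      rw [e1, Wf_mul _ _ (fun i => cd2.mul (contDiff_phi _)) cd1, Wf_cons_one]
      · simp only [b, Fin.cons_succ, hc']
        rw [Wf_smul, Wf_mul _ _ (fun i => contDiff_phi _) cd2]
      · ext y
        simp only [b, Fin.cons_zero, phi, conjHermite_eq, pe, eval_one, mul_one]
        rw [mul_comm, hE]
    change _ * Wf (n + 1) (fun i => phi (b i)) x = _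
    rw [e2, hnc]
    have e3 : Real.exp (x ^ 2) ^ (n + 1) * Real.exp (-x ^ 2) ^ n = Real.exp (x ^ 2) := by
      rw [pow_succ, mul_right_comm, ← mul_pow, hE]; simp
    have e4 : Real.exp (-((S.ncard + 1 : ℕ) : ℝ) * x ^ 2) * Real.exp (x ^ 2) =
        Real.exp (-(S.ncard : ℝ) * x ^ 2) := by
      rw [← Real.exp_add]; congr 1; push_cast; ring
    dsimp only
    rw [← e4]
    linear_combination Real.exp (-((S.ncard + 1 : ℕ) : ℝ) * x ^ 2) * (∏ i, c i) *
      Wf n (fun i => phi (a i)) x * e3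

/-! ### Maya diagrams -/

def RepM (M : Set ℤ) (w : ℝ → ℝ) : Prop := Rep (MayaMinus M) (MayaPlus M) w

theorem repM_shift_one (M : Set ℤ) (w : ℝ → ℝ) : RepM M w ↔ RepM (shiftM M 1) w := by
  unfold RepM
  by_cases h0 : (0 : ℤ) ∈ M
  · have e1 : MayaPlus M = insert 0 (Nat.succ '' MayaPlus (shiftM M 1)) := by
      ext a
      rcases a with _ | a
      · simp [MayaPlus, h0]
      · simp [MayaPlus, shiftM]
    have e2 : MayaMinus (shiftM M 1) = Nat.succ '' MayaMinus M := by
      ext a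
      rcases a with _ | a
      · simp [MayaMinus, shiftM, h0]
      · simp [MayaMinus, shiftM]
        ring_nf
    rw [e1, e2]
    refine ⟨fun h => ?_, stepA⟩
    obtain ⟨hS, hT⟩ := h.finite
    have hT' : (MayaPlus (shiftM M 1)).Finite :=
      (hT.subset (Set.subset_insert _ _)).of_finite_image Nat.succ_injective.injOn
    obtain ⟨w', hw'⟩ := exists_rep (hS.image Nat.succ) hT'
    exact hw'.of_eqv (h.unique (stepA hw'))
  · have e1 : MayaPlus M = Nat.succ '' MayaPlus (shiftM M 1) := by
      ext a
      rcases a with _ | a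
      · simp [MayaPlus, h0]
      · simp [MayaPlus, shiftM]
    have e2 : MayaMinus (shiftM M 1) = insert 0 (Nat.succ '' MayaMinus M) := by
      ext a
      rcases a with _ | a
      · simp [MayaMinus, shiftM, h0]
      · simp [MayaMinus, shiftM]
        ring_nf
    rw [e1, e2]
    refine ⟨stepB, fun h => ?_⟩
    obtain ⟨hS, hT⟩ := h.finite
    have hS' : (MayaMinus M).Finite :=
      (hS.subset (Set.subset_insert _ _)).of_finite_image Nat.succ_injective.injOn
    obtain ⟨w', hw'⟩ := exists_rep hS' (hT.image Nat.succ)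
    exact hw'.of_eqv (h.unique (stepB hw'))

theorem repM_shift_nat (n : ℕ) (M : Set ℤ) (w : ℝ → ℝ) :
    RepM M w ↔ RepM (shiftM M n) w := by
  induction n with
  | zero => simp [shiftM]
  | succ n ih =>
    rw [ih, repM_shift_one]
    have : shiftM (shiftM M n) 1 = shiftM M ((n + 1 : ℕ) : ℤ) := by
      ext m
      simp only [shiftM, Set.mem_ofPred_eq]
      rw [show m + 1 + (n : ℤ) = m + ((n + 1 : ℕ) : ℤ) by push_cast; ring]
    rw [this]

theorem repM_shift (k : ℤ) (M : Set ℤ) (w : ℝ → ℝ) :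
    RepM M w ↔ RepM (shiftM M k) w := by
  obtain ⟨n, rfl | rfl⟩ := k.eq_nat_or_neg
  · exact repM_shift_nat n M w
  · rw [repM_shift_nat n (shiftM M (-n))]
    have : shiftM (shiftM M (-n)) n = M := by ext m; simp [shiftM]
    rw [this]

theorem rep_pW {p q : ℕ} {M : Set ℤ} (s : Fin p → ℕ) (t : Fin q → ℕ)
    (hf : IsFrobenius M s t) : RepM M (pW p q s t) := by
  obtain ⟨hs, ht, hS, hT⟩ := hf
  refine ⟨p + q, fun i => if h : (i : ℕ) < p then Sum.inl (s ⟨i, h⟩) else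
    Sum.inr (t ⟨p + q - 1 - (i : ℕ), by have := i.isLt; omega⟩), ?_, ?_, 1, one_ne_zero, ?_⟩
  · intro i j hij
    have hi := i.isLt
    have hj := j.isLt
    dsimp only at hij
    split_ifs at hij with h1 h2 h2
    · have := hs.injective (Sum.inl_injective hij)
      simp only [Fin.mk.injEq] at this
      exact Fin.ext this
    · have := ht.injective (Sum.inr_injective hij)
      simp only [Fin.mk.injEq] at this
      exact Fin.ext (by omega)
  · rw [← hS, ← hT]
    ext x
    constructor
    · rintro ⟨i, rfl⟩
      dsimp only
      split_ifs with h
      · exact Or.inl ⟨_, ⟨_, rfl⟩, rfl⟩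
      · exact Or.inr ⟨_, ⟨_, rfl⟩, rfl⟩
    · rintro (⟨_, ⟨i, rfl⟩, rfl⟩ | ⟨_, ⟨j, rfl⟩, rfl⟩)
      · refine ⟨⟨i, by omega⟩, ?_⟩
        simp
      · refine ⟨⟨p + q - 1 - j, by omega⟩, ?_⟩
        have hj := j.isLt
        have h1 : ¬ (p + q - 1 - (j : ℕ) < p) := by omega
        have h2 : p + q - 1 - (p + q - 1 - (j : ℕ)) = j := by omega
        simp [h1, h2]
  · intro x
    have hc : (MayaMinus M).ncard = p := by
      rw [← hS, ← Set.image_univ, Set.ncard_image_of_injective _ hs.injective]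
      simp [Set.ncard_univ]
    rw [hc, one_mul]
    unfold pW Wf
    congr 2
    ext i k
    simp only [Matrix.of_apply]
    congr 1
    ext y
    split_ifs <;> rfl

end PWProof

/-- Corollary `uniquewronsk`. Every Hermite pseudo-Wronskian is a nonzero
scalar multiple of the Wronskian `Wr[H_{m_ℓ}, …, H_{m₁}]`, where `m₁ > ⋯ > m_ℓ > 0` are
the positive elements of the standard-form representative `M − min(ℤ \ M)` of `M`.
(0-based indexing: `msq (i-1)` is the paper's `m_i`, so row `i` of the Wronskian matrix,
counting from `0`, is `H_{msq i.rev}`.) -/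
theorem pseudoWronskian_eq_smul_wronskian (M : Set ℤ) (hM : IsMaya M)
    {p q : ℕ} (s : Fin p → ℕ) (t : Fin q → ℕ) (hf : IsFrobenius M s t)
    (k : ℤ) (hk : IsLeast {m : ℤ | m ∉ M} k)
    {ℓ : ℕ} (msq : Fin ℓ → ℕ) (hms : StrictAnti msq) (hpos : ∀ i, 0 < msq i)
    (hrange : Set.range msq = MayaPlus (shiftM M k)) :
    ∃ c : ℝ, c ≠ 0 ∧ ∀ x : ℝ,
      pW p q s t x =
        c * Matrix.det (Matrix.of fun i j : Fin ℓ =>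
          iteratedDeriv (j : ℕ) (physHermite (msq i.rev)) x) := by
  have h1 := (PWProof.repM_shift k M _).1 (PWProof.rep_pW s t hf)
  have hemp : MayaMinus (shiftM M k) = ∅ := by
    ext a
    simp only [MayaMinus, shiftM, Set.mem_ofPred_eq, Set.mem_empty_iff_false, iff_false, not_not]
    by_contra hc
    have := hk.2 hc
    omega
  have h2 : PWProof.RepM (shiftM M k) (fun x => Matrix.det (Matrix.of fun i j : Fin ℓ =>
          iteratedDeriv (j : ℕ) (physHermite (msq i.rev)) x)) := by
    refine ⟨ℓ, fun i => Sum.inr (msq i.rev), ?_, ?_, 1, one_ne_zero, ?_⟩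
    · exact Sum.inr_injective.comp (hms.injective.comp Fin.rev_injective)
    · rw [hemp, ← hrange, Set.image_empty, Set.empty_union]
      ext x
      constructor
      · rintro ⟨i, rfl⟩
        exact ⟨_, ⟨_, rfl⟩, rfl⟩
      · rintro ⟨_, ⟨i, rfl⟩, rfl⟩
        exact ⟨i.rev, by simp⟩
    · intro x
      rw [hemp]
      simp [PWProof.Wf, PWProof.phi]
  exact h1.unique h2
end

section
/- Let M be a Maya diagram and M' = M + k for some k ∈ ℤ. Define the rational extension potential U_M(x) := x² − 2·(d²/dx²) log H_M(x) + 2·#M₊ − 2·#M₋, for x ∈ ℝ with H_M(x) ≠ 0. Then H_{M'} and H_M have the same zeros and U_{M'}(x) = U_M(x) + 2k for all x with H_M(x) ≠ 0; in particular (log H_{M'})″ = (log H_M)″ wherever defined, and #M'₊ − #M'₋ = #M₊ − #M₋ + k. -/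
open scoped ContDiff

/-- `A a n` is the `n`-th derivative of `exp (a x²)`. -/
noncomputable def gA (a : ℝ) (n : ℕ) : ℝ → ℝ := iteratedDeriv n (fun y => Real.exp (a * y ^ 2))

lemma contDiff_iter_aux {f : ℝ → ℝ} (hf : ContDiff ℝ ∞ f) (n : ℕ) :
    ContDiff ℝ ∞ (iteratedDeriv n f) := by
  induction n with
  | zero => simpa using hf
  | succ n ih => rw [iteratedDeriv_succ]; exact (contDiff_infty_iff_deriv.1 ih).2

lemma gA_contDiff (a : ℝ) (n : ℕ) : ContDiff ℝ ∞ (gA a n) :=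
  contDiff_iter_aux (by fun_prop) n

lemma gA_hasDerivAt (a : ℝ) (n : ℕ) (x : ℝ) : HasDerivAt (gA a n) (gA a (n + 1) x) x := by
  have h : gA a (n + 1) = deriv (gA a n) := iteratedDeriv_succ
  rw [h]
  exact ((gA_contDiff a n).differentiable (by simp) x).hasDerivAt

lemma gA_zero (a x : ℝ) : gA a 0 x = Real.exp (a * x ^ 2) := by simp [gA]

lemma exp_hasDerivAt (a x : ℝ) :
    HasDerivAt (fun y : ℝ => Real.exp (a * y ^ 2)) (2 * a * x * Real.exp (a * x ^ 2)) x := by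
  have h := ((hasDerivAt_pow 2 x).const_mul a).exp
  refine h.congr_deriv ?_
  push_cast; ring

lemma gA_one (a x : ℝ) : gA a 1 x = 2 * a * x * gA a 0 x := by
  have h := gA_hasDerivAt a 0 x
  have h2 := exp_hasDerivAt a x
  have e : gA a 0 = fun y => Real.exp (a * y ^ 2) := by funext y; exact gA_zero a y
  rw [e] at h ⊢
  exact h.unique h2

lemma gA_rec (a : ℝ) (n : ℕ) : ∀ x : ℝ,
    gA a (n + 2) x = 2 * a * x * gA a (n + 1) x + 2 * a * (n + 1) * gA a n x := by
  induction n with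
  | zero =>
    intro x
    have h := gA_hasDerivAt a 1 x
    have h2 := ((hasDerivAt_id x).const_mul (2 * a)).mul (gA_hasDerivAt a 0 x)
    have e : gA a 1 = (fun y => 2 * a * id y) * gA a 0 := by funext y; simp [gA_one a y]
    rw [← e] at h2
    rw [h.unique h2]; simp; ring
  | succ n ih =>
    intro x
    have h := gA_hasDerivAt a (n + 2) x
    have h2 := (((hasDerivAt_id x).const_mul (2 * a)).mul (gA_hasDerivAt a (n + 1) x)).add
      ((gA_hasDerivAt a n x).const_mul (2 * a * (n + 1)))
    have e : gA a (n + 2) = (fun y => 2 * a * id y) * gA a (n + 1)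
      + fun y => 2 * a * (n + 1) * gA a n y := by funext y; simp [ih y]
    rw [← e] at h2
    rw [h.unique h2]; simp; ring

lemma gP_hasDerivAt (a : ℝ) (n : ℕ) (x : ℝ) :
    HasDerivAt (fun y => Real.exp (-a * y ^ 2) * gA a (n + 1) y)
      (2 * a * (n + 1) * (Real.exp (-a * x ^ 2) * gA a n x)) x := by
  have h := (exp_hasDerivAt (-a) x).mul (gA_hasDerivAt a (n + 1) x)
  refine h.congr_deriv ?_
  rw [gA_rec]; ring

lemma gP_zero (a x : ℝ) : Real.exp (-a * x ^ 2) * gA a 0 x = 1 := by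
  rw [gA_zero, ← Real.exp_add]; simp

lemma physHermite_eq (n : ℕ) (x : ℝ) :
    physHermite n x = (-1) ^ n * (Real.exp (x ^ 2) * gA (-1) n x) := by
  simp [physHermite, gA, mul_assoc]

lemma iter_ofReal (n : ℕ) : ∀ x : ℝ,
    iteratedDeriv n (fun w : ℂ => Complex.exp (w ^ 2)) (x : ℂ) = ((gA 1 n x : ℝ) : ℂ) := by
  induction n with
  | zero => intro x; simp [gA]
  | succ n ih =>
    intro x
    have hc : ContDiff ℂ ∞ (fun w : ℂ => Complex.exp (w ^ 2)) := by fun_prop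
    have hd := hc.differentiable_iteratedDeriv n (by exact_mod_cast ENat.natCast_lt_top n)
    have h := (hd (x : ℂ)).hasDerivAt.comp_ofReal
    rw [← iteratedDeriv_succ] at h
    have h2 := (gA_hasDerivAt 1 n x).ofReal_comp
    have e : (fun y : ℝ => iteratedDeriv n (fun w : ℂ => Complex.exp (w ^ 2)) (y : ℂ))
      = fun y : ℝ => ((gA 1 n y : ℝ) : ℂ) := funext ih
    rw [e] at h
    exact h.unique h2

lemma conjHermite_eq (n : ℕ) (x : ℝ) :
    Real.exp (x ^ 2) * conjHermite n x = gA 1 n x := by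
  have hc : ContDiff ℂ n (fun w : ℂ => Complex.exp (w ^ 2)) := by fun_prop
  have h1 := iteratedDeriv_comp_const_mul hc (-Complex.I)
  have e : (fun w : ℂ => Complex.exp ((-Complex.I * w) ^ 2)) = fun w => Complex.exp (-w ^ 2) := by
    funext w; congr 1; rw [mul_pow, neg_sq, Complex.I_sq]; ring
  rw [e] at h1
  have h3 : -Complex.I * (Complex.I * (x : ℂ)) = (x : ℂ) := by
    rw [← mul_assoc, neg_mul, Complex.I_mul_I]; ring
  have h4 : (Complex.I * (x : ℂ)) ^ 2 = ((-x ^ 2 : ℝ) : ℂ) := by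
    rw [mul_pow, Complex.I_sq]; push_cast; ring
  have h5 : Complex.I ^ (-(n : ℤ)) * ((-1) ^ n * (-Complex.I) ^ n) = 1 := by
    rw [← mul_pow, neg_one_mul, neg_neg, zpow_neg, zpow_natCast]
    exact inv_mul_cancel₀ (pow_ne_zero _ Complex.I_ne_zero)
  have h6 : Complex.I ^ (-(n : ℤ)) * hermiteC n (Complex.I * x)
      = ((Real.exp (-x ^ 2) * gA 1 n x : ℝ) : ℂ) := by
    simp only [hermiteC]
    rw [h1]
    simp only []
    rw [h3, h4, iter_ofReal, ← Complex.ofReal_exp]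
    push_cast
    linear_combination (Complex.exp (-(x:ℂ) ^ 2) * (gA 1 n x : ℂ)) * h5
  rw [conjHermite, h6, Complex.ofReal_re, ← mul_assoc, ← Real.exp_add]
  simp

/-- The functions labelled by integers. -/
noncomputable def gF : ℤ → ℝ → ℝ
  | Int.ofNat t => physHermite t
  | Int.negSucc s => fun y => Real.exp (y ^ 2) * conjHermite s y

lemma gF_ofNat (t : ℕ) : gF (Int.ofNat t) = fun y => (-1) ^ t * (Real.exp (y ^ 2) * gA (-1) t y) := by
  funext y; exact physHermite_eq t y

lemma gF_negSucc (s : ℕ) : gF (Int.negSucc s) = gA 1 s := by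
  funext y; exact conjHermite_eq s y

lemma gF_contDiff (m : ℤ) : ContDiff ℝ ∞ (gF m) := by
  cases m with
  | ofNat t =>
    rw [gF_ofNat]
    have := gA_contDiff (-1) t
    fun_prop
  | negSucc s => rw [gF_negSucc]; exact gA_contDiff 1 s

lemma gF_zero : gF 0 = fun _ => 1 := by
  have h : (0 : ℤ) = Int.ofNat 0 := rfl
  rw [h, gF_ofNat]
  funext y
  have := gP_zero (-1) y
  simpa using this

/-- The functions multiplied by `exp (-x²)`. -/
noncomputable def gFh (m : ℤ) : ℝ → ℝ := fun y => Real.exp (-y ^ 2) * gF m y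

lemma gFh_negone : gFh (-1) = fun _ => 1 := by
  have h : (-1 : ℤ) = Int.negSucc 0 := rfl
  rw [h]; unfold gFh; rw [gF_negSucc]
  funext y
  have := gP_zero 1 y
  simpa using this

lemma gF_deriv (m : ℤ) (hm : m ≠ -1) :
    ∃ c : ℝ, c ≠ 0 ∧ deriv (gF (m + 1)) = fun y => c * gF m y := by
  cases m with
  | ofNat t =>
    refine ⟨2 * (t + 1), by positivity, ?_⟩
    have e : Int.ofNat t + 1 = Int.ofNat (t + 1) := rfl
    rw [e, gF_ofNat, gF_ofNat]
    funext y
    have h := ((gP_hasDerivAt (-1) t y).const_mul ((-1) ^ (t + 1))).deriv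
    simp only [neg_neg, one_mul] at h
    rw [h]; ring
  | negSucc s =>
    cases s with
    | zero => exact absurd rfl hm
    | succ s =>
      refine ⟨1, one_ne_zero, ?_⟩
      have e : Int.negSucc (s + 1) + 1 = Int.negSucc s := rfl
      rw [e, gF_negSucc, gF_negSucc]
      funext y
      rw [(gA_hasDerivAt 1 s y).deriv, one_mul]

lemma gFh_deriv (m : ℤ) (hm : m ≠ -1) :
    ∃ c : ℝ, c ≠ 0 ∧ deriv (gFh m) = fun y => c * gFh (m + 1) y := by
  cases m with
  | ofNat t =>
    refine ⟨-1, by norm_num, ?_⟩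
    have e : Int.ofNat t + 1 = Int.ofNat (t + 1) := rfl
    have e2 : ∀ t, gFh (Int.ofNat t) = fun y => (-1) ^ t * gA (-1) t y := by
      intro t
      unfold gFh; rw [gF_ofNat]
      funext y
      have : Real.exp (-y ^ 2) * Real.exp (y ^ 2) = 1 := by rw [← Real.exp_add]; simp
      linear_combination ((-1) ^ t * gA (-1) t y) * this
    rw [e, e2, e2]
    funext y
    rw [((gA_hasDerivAt (-1) t y).const_mul _).deriv]; ring
  | negSucc s =>
    cases s with
    | zero => exact absurd rfl hm
    | succ s =>
      refine ⟨2 * (s + 1), by positivity, ?_⟩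
      have e : Int.negSucc (s + 1) + 1 = Int.negSucc s := rfl
      rw [e]; unfold gFh; rw [gF_negSucc, gF_negSucc]
      funext y
      have h := (gP_hasDerivAt 1 s y).deriv
      simp only [neg_mul, one_mul, mul_one] at h
      exact h

/-- The Wronskian of a finite family of functions. -/
noncomputable def gW {n : ℕ} (f : Fin n → ℝ → ℝ) (x : ℝ) : ℝ :=
  Matrix.det (Matrix.of fun i k : Fin n => iteratedDeriv (k : ℕ) (f i) x)

lemma gW_cons_one {n : ℕ} (f : Fin (n + 1) → ℝ → ℝ) (h0 : f 0 = fun _ => 1) (x : ℝ) :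
    gW f x = gW (fun i : Fin n => deriv (f i.succ)) x := by
  unfold gW
  rw [Matrix.det_succ_row_zero, Finset.sum_eq_single 0]
  · simp only [Matrix.of_apply, h0, iteratedDeriv_const]
    simp only [Fin.val_zero, pow_zero, if_true, one_mul]
    congr 1
    ext i k
    simp [iteratedDeriv_succ']
  · intro j _ hj
    have : (j : ℕ) ≠ 0 := fun h => hj (Fin.ext h)
    simp [h0, iteratedDeriv_const, this]
  · simp

lemma gW_scale {n : ℕ} (f : Fin n → ℝ → ℝ) (c : Fin n → ℝ) (x : ℝ) :
    gW (fun i y => c i * f i y) x = (∏ i, c i) * gW f x := by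
  unfold gW
  rw [← Matrix.det_mul_column]
  congr 1
  ext i k
  simp only [Matrix.of_apply]
  exact iteratedDeriv_const_mul_field (c i) (f i)

lemma gW_mul {n : ℕ} (g : ℝ → ℝ) (f : Fin n → ℝ → ℝ) (hg : ContDiff ℝ ∞ g)
    (hf : ∀ i, ContDiff ℝ ∞ (f i)) (x : ℝ) :
    gW (fun i y => f i y * g y) x = g x ^ n * gW f x := by
  let T : Matrix (Fin n) (Fin n) ℝ := Matrix.of fun j k =>
    ((k : ℕ).choose (j : ℕ) : ℝ) * iteratedDeriv ((k : ℕ) - j) g x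
  have hT : T.det = g x ^ n := by
    rw [Matrix.det_of_isUpperTriangular]
    · simp [T]
    · intro i j hij
      have : (j : ℕ) < i := hij
      simp [T, Nat.choose_eq_zero_of_lt this]
  rw [← hT, mul_comm]
  unfold gW
  rw [← Matrix.det_mul]
  congr 1
  ext i k
  have hle : ((k : ℕ) : ℕ∞ω) ≤ ∞ := by exact_mod_cast le_top
  have h := iteratedDeriv_mul (n := k) (x := x) ((hf i).contDiffAt.of_le hle)
    (hg.contDiffAt.of_le hle)
  rw [Matrix.mul_apply]
  simp only [Matrix.of_apply, T]
  refine h.trans ?_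
  rw [Fin.sum_univ_eq_sum_range (fun j => iteratedDeriv j (f i) x *
    (((k : ℕ).choose j : ℝ) * iteratedDeriv ((k : ℕ) - j) g x)) n]
  rw [← Finset.sum_subset (Finset.range_mono (Nat.succ_le_of_lt k.isLt))]
  · refine Finset.sum_congr rfl fun j _ => by ring
  · intro j _ hj
    have : (k : ℕ) < j := by simpa using hj
    simp [Nat.choose_eq_zero_of_lt this]

/-- Proportionality by a nonzero constant. -/
def PropTo (f g : ℝ → ℝ) : Prop := ∃ c : ℝ, c ≠ 0 ∧ ∀ x, f x = c * g x

lemma PropTo.symm {f g : ℝ → ℝ} (h : PropTo f g) : PropTo g f := by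
  obtain ⟨c, hc, h⟩ := h
  exact ⟨c⁻¹, inv_ne_zero hc, fun x => by rw [h]; field_simp⟩

lemma PropTo.trans {f g k : ℝ → ℝ} (h : PropTo f g) (h' : PropTo g k) : PropTo f k := by
  obtain ⟨c, hc, h⟩ := h
  obtain ⟨d, hd, h'⟩ := h'
  exact ⟨c * d, mul_ne_zero hc hd, fun x => by rw [h, h']; ring⟩

/-- number of negative labels -/
def gN (L : Finset ℤ) : ℕ := (L.filter (· < 0)).card

/-- The pseudo-Wronskian of an enumeration, with a given exponent -/
noncomputable def gE {n : ℕ} (p : ℕ) (a : Fin n → ℤ) (x : ℝ) : ℝ :=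
  Real.exp (-(p : ℝ) * x ^ 2) * gW (fun i => gF (a i)) x

/-- The pseudo-Wronskian of a finite label set. -/
noncomputable def gG (L : Finset ℤ) : ℝ → ℝ := gE (gN L) (L.orderEmbOfFin rfl)

lemma gG_enum {n : ℕ} (L : Finset ℤ) (a : Fin n → ℤ) (ha : Function.Injective a)
    (hL : ∀ m, m ∈ L ↔ ∃ i, a i = m) : PropTo (gE (gN L) a) (gG L) := by
  have himg : L = Finset.univ.image a := by ext m; simp [hL]
  have hcard : L.card = n := by
    rw [himg, Finset.card_image_of_injective _ ha]; simp
  subst hcard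
  let σ : Fin L.card → Fin L.card := fun i =>
    (L.orderIsoOfFin rfl).symm ⟨a i, (hL _).2 ⟨i, rfl⟩⟩
  have hσ : ∀ i, L.orderEmbOfFin rfl (σ i) = a i := by
    intro i
    simp only [σ, ← Finset.coe_orderIsoOfFin_apply, OrderIso.apply_symm_apply]
  have hinj : Function.Injective σ := by
    intro i j h
    apply ha
    rw [← hσ, ← hσ, h]
  let e : Equiv.Perm (Fin L.card) := Equiv.ofBijective σ (Finite.injective_iff_bijective.1 hinj)
  refine ⟨((Equiv.Perm.sign e : ℤ) : ℝ), by
    rcases Int.units_eq_one_or (Equiv.Perm.sign e) with h | h <;> simp [h], fun x => ?_⟩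
  unfold gG gE gW
  rw [mul_left_comm, ← Matrix.det_permute]
  congr 2
  ext i k
  simp only [Matrix.of_apply, Matrix.submatrix_apply, id]
  rw [← hσ i]; rfl

lemma gW_stepA {n : ℕ} (a : Fin n → ℤ) (ha : ∀ i, a i ≠ -1) (b : Fin (n + 1) → ℤ)
    (hb0 : b 0 = 0) (hb : ∀ i, b (Fin.succ i) = a i + 1) :
    PropTo (gW fun i => gF (b i)) (gW fun i => gF (a i)) := by
  choose c hc hd using fun i => gF_deriv (a i) (ha i)
  refine ⟨∏ i, c i, Finset.prod_ne_zero_iff.2 fun i _ => hc i, fun x => ?_⟩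
  rw [gW_cons_one _ (by rw [hb0, gF_zero]), ← gW_scale]
  simp only [hb, hd]

lemma gF_eq_gFh (m : ℤ) : gF m = fun y => gFh m y * Real.exp (y ^ 2) := by
  funext y
  have : Real.exp (-y ^ 2) * Real.exp (y ^ 2) = 1 := by rw [← Real.exp_add]; simp
  simp only [gFh]
  linear_combination (- gF m y) * this

lemma gFh_contDiff (m : ℤ) : ContDiff ℝ ∞ (gFh m) := by
  have := gF_contDiff m
  unfold gFh
  fun_prop

lemma gW_F_Fh {n : ℕ} (a : Fin n → ℤ) (x : ℝ) :
    gW (fun i => gF (a i)) x = Real.exp (x ^ 2) ^ n * gW (fun i => gFh (a i)) x := by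
  rw [← gW_mul (fun y => Real.exp (y ^ 2)) _ (by fun_prop) (fun i => gFh_contDiff _)]
  congr 1
  funext i
  exact gF_eq_gFh (a i)

lemma gW_stepB {n : ℕ} (a : Fin n → ℤ) (ha : ∀ i, a i ≠ -1) (b : Fin (n + 1) → ℤ)
    (hb0 : b 0 = -1) (hb : ∀ i, b (Fin.succ i) = a i) :
    PropTo (gW fun i => gF (b i)) (fun x => Real.exp (x ^ 2) * gW (fun i => gF (a i + 1)) x) := by
  choose c hc hd using fun i => gFh_deriv (a i) (ha i)
  refine ⟨∏ i, c i, Finset.prod_ne_zero_iff.2 fun i _ => hc i, fun x => ?_⟩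
  beta_reduce
  rw [gW_F_Fh, gW_F_Fh (fun i => a i + 1), gW_cons_one _ (by rw [hb0, gFh_negone])]
  simp only [hb, hd]
  rw [gW_scale (fun i => gFh (a i + 1))]
  ring

/-- shift of labels by one -/
def gS (L : Finset ℤ) : Finset ℤ := L.image (· + 1)

lemma mem_gS (L : Finset ℤ) (m : ℤ) : m ∈ gS L ↔ m - 1 ∈ L := by
  simp only [gS, Finset.mem_image]
  constructor
  · rintro ⟨a, h, rfl⟩; simpa using h
  · intro h; exact ⟨_, h, by ring⟩

lemma gS_card (L : Finset ℤ) : (gS L).card = L.card :=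
  Finset.card_image_of_injective _ (add_left_injective 1)

lemma gS_gN (L : Finset ℤ) (h : (-1 : ℤ) ∉ L) : gN (gS L) = gN L := by
  unfold gN
  have : (gS L).filter (· < 0) = gS (L.filter (· < 0)) := by
    ext m
    simp only [Finset.mem_filter, mem_gS]
    constructor
    · rintro ⟨h1, h2⟩; exact ⟨h1, by omega⟩
    · rintro ⟨h1, h2⟩
      refine ⟨h1, ?_⟩
      have : m ≠ 0 := by rintro rfl; exact h h1
      omega
  rw [this, gS_card]

lemma mem_emb (L : Finset ℤ) (m : ℤ) : m ∈ L ↔ ∃ i, L.orderEmbOfFin rfl i = m := by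
  have := Finset.range_orderEmbOfFin L rfl
  rw [← Finset.mem_coe, ← this]; rfl

lemma gG_stepA (L : Finset ℤ) (h : (-1 : ℤ) ∉ L) :
    PropTo (gG (insert 0 (gS L))) (gG L) := by
  obtain ⟨a, ha⟩ : ∃ a : Fin L.card → ℤ, a = ⇑(L.orderEmbOfFin rfl) := ⟨_, rfl⟩
  have hmem : ∀ m, m ∈ L ↔ ∃ i, a i = m := by rw [ha]; exact mem_emb L
  have hai : Function.Injective a := by rw [ha]; exact (L.orderEmbOfFin rfl).injective
  have hne : ∀ i, a i ≠ -1 := fun i hi => h ((hmem _).2 ⟨i, hi⟩)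
  let b : Fin (L.card + 1) → ℤ := Fin.cons 0 (fun i => a i + 1)
  have hb : Function.Injective b := by
    rw [Fin.cons_injective_iff]
    refine ⟨?_, fun i j hij => hai (by simpa using hij)⟩
    rintro ⟨i, hi⟩
    have := hne i
    simp only at hi
    omega
  have hb2 : ∀ m, m ∈ insert 0 (gS L) ↔ ∃ i, b i = m := by
    intro m
    rw [Finset.mem_insert, mem_gS, hmem, Fin.exists_fin_succ]
    simp only [b, Fin.cons_zero, Fin.cons_succ]
    refine or_congr eq_comm (exists_congr fun i => by omega)
  have hN : gN (insert 0 (gS L)) = gN L := by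
    rw [← gS_gN L h]; unfold gN; rw [Finset.filter_insert]; simp
  refine (gG_enum _ b hb hb2).symm.trans ?_
  obtain ⟨c, hc, hW⟩ := gW_stepA a hne b rfl (fun i => rfl)
  refine ⟨c, hc, fun x => ?_⟩
  simp only [gG, gE, hN]
  rw [hW, ← ha]; ring

lemma gG_stepB (L : Finset ℤ) (h : (-1 : ℤ) ∉ L) :
    PropTo (gG (gS L)) (gG (insert (-1) L)) := by
  obtain ⟨a, ha⟩ : ∃ a : Fin L.card → ℤ, a = ⇑(L.orderEmbOfFin rfl) := ⟨_, rfl⟩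
  have hmem : ∀ m, m ∈ L ↔ ∃ i, a i = m := by rw [ha]; exact mem_emb L
  have hai : Function.Injective a := by rw [ha]; exact (L.orderEmbOfFin rfl).injective
  have hne : ∀ i, a i ≠ -1 := fun i hi => h ((hmem _).2 ⟨i, hi⟩)
  let b : Fin (L.card + 1) → ℤ := Fin.cons (-1) a
  have hb : Function.Injective b := by
    rw [Fin.cons_injective_iff]
    refine ⟨?_, hai⟩
    rintro ⟨i, hi⟩
    exact hne i hi
  have hb2 : ∀ m, m ∈ insert (-1) L ↔ ∃ i, b i = m := by
    intro m
    rw [Finset.mem_insert, hmem, Fin.exists_fin_succ]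
    simp only [b, Fin.cons_zero, Fin.cons_succ]
    exact or_congr eq_comm Iff.rfl
  have hs2 : ∀ m, m ∈ gS L ↔ ∃ i, a i + 1 = m := by
    intro m
    rw [mem_gS, hmem]
    exact exists_congr fun i => by omega
  have hN : gN (insert (-1) L) = gN L + 1 := by
    unfold gN; rw [Finset.filter_insert]
    rw [if_pos (by norm_num), Finset.card_insert_of_notMem]
    simp [h]
  have h1 := gG_enum _ b hb hb2
  have h2 := gG_enum (gS L) (fun i => a i + 1) (fun i j hij => hai (by simpa using hij)) hs2
  refine h2.symm.trans (PropTo.trans (PropTo.symm ?_) h1)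
  obtain ⟨c, hc, hW⟩ := gW_stepB a hne b rfl (fun i => rfl)
  refine ⟨c, hc, fun x => ?_⟩
  simp only [gE, hN, gS_gN L h]
  rw [hW]
  have : Real.exp (-((gN L + 1 : ℕ) : ℝ) * x ^ 2) * Real.exp (x ^ 2)
      = Real.exp (-(gN L : ℝ) * x ^ 2) := by
    rw [← Real.exp_add]; congr 1; push_cast; ring
  rw [← this]; ring

/-- `L` is the label set of `M`. -/
def IsLab (L : Finset ℤ) (M : Set ℤ) : Prop := ∀ m, m ∈ L ↔ (0 ≤ m ↔ m ∈ M)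

lemma step_one (L : Finset ℤ) (M : Set ℤ) (h : IsLab L M) :
    ∃ L' : Finset ℤ, IsLab L' (shiftM M (-1)) ∧ PropTo (gG L') (gG L) ∧
      (L'.card : ℤ) - 2 * gN L' = L.card - 2 * gN L + 1 := by
  by_cases h1 : (-1 : ℤ) ∈ L
  · have hn : (-1 : ℤ) ∉ L.erase (-1) := by simp
    have hi : insert (-1) (L.erase (-1)) = L := Finset.insert_erase h1
    have hB := gG_stepB _ hn
    rw [hi] at hB
    refine ⟨gS (L.erase (-1)), ?_, hB, ?_⟩
    · intro m
      have hm := h (m - 1)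
      have hm1 := h (-1)
      rw [mem_gS, Finset.mem_erase, hm]
      simp only [shiftM, Set.mem_ofPred_eq]
      by_cases h0 : m = 0
      · subst h0
        have := hm1.1 h1
        simp at this
        simp [this]
      · have e : m + -1 = m - 1 := rfl
        rw [e]
        have : (0 ≤ m - 1) ↔ 0 ≤ m := by omega
        rw [this]
        have : m - 1 ≠ -1 := by omega
        simp [this]
    · rw [gS_card, gS_gN _ hn]
      have c1 : L.card = (L.erase (-1)).card + 1 := by
        rw [Finset.card_erase_add_one h1]
      have c2 : gN L = gN (L.erase (-1)) + 1 := by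
        conv_lhs => rw [← hi]
        unfold gN; rw [Finset.filter_insert]
        rw [if_pos (by norm_num), Finset.card_insert_of_notMem]
        simp
      rw [c1, c2]; push_cast; ring
  · refine ⟨insert 0 (gS L), ?_, gG_stepA L h1, ?_⟩
    · intro m
      have hm := h (m - 1)
      have hm1 := h (-1)
      rw [Finset.mem_insert, mem_gS, hm]
      simp only [shiftM, Set.mem_ofPred_eq]
      by_cases h0 : m = 0
      · subst h0
        have := fun hh => h1 (hm1.2 hh)
        simp at this
        simp [this]
      · have e : m + -1 = m - 1 := rfl
        rw [e]
        have : (0 ≤ m - 1) ↔ 0 ≤ m := by omega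
        rw [this]
        simp [h0]
    · have hN : gN (insert 0 (gS L)) = gN L := by
        rw [← gS_gN L h1]; unfold gN; rw [Finset.filter_insert]; simp
      rw [hN, Finset.card_insert_of_notMem (by rw [mem_gS]; simpa using h1), gS_card]
      push_cast; ring

lemma step_many (k : ℕ) : ∀ (L L' : Finset ℤ) (M : Set ℤ), IsLab L M →
    IsLab L' (shiftM M (-k)) → PropTo (gG L') (gG L) ∧
      (L'.card : ℤ) - 2 * gN L' = L.card - 2 * gN L + k := by
  induction k with
  | zero =>
    intro L L' M h h'
    have : L' = L := by
      ext m
      rw [h m, h' m]; simp [shiftM]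
    subst this
    exact ⟨⟨1, one_ne_zero, fun x => by simp⟩, by simp⟩
  | succ k ih =>
    intro L L' M h h'
    obtain ⟨L1, hl, hp, hc⟩ := step_one L M h
    have := ih L1 L' _ hl (by
      convert h' using 1
      ext m; simp only [shiftM, Set.mem_ofPred_eq]
      push_cast
      rw [show m + -(k : ℤ) + -1 = m + -((k : ℤ) + 1) by ring])
    exact ⟨this.1.trans hp, by rw [this.2, hc]; push_cast; ring⟩

lemma pW_enum {p q : ℕ} {M : Set ℤ} (s : Fin p → ℕ) (t : Fin q → ℕ) (hf : IsFrobenius M s t) :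
    ∃ L : Finset ℤ, IsLab L M ∧ PropTo (pW p q s t) (gG L) ∧ L.card = p + q ∧ gN L = p ∧
      Continuous (pW p q s t) := by
  obtain ⟨hs, ht, hrs, hrt⟩ := hf
  let a : Fin (p + q) → ℤ := fun i => if h : (i : ℕ) < p then Int.negSucc (s ⟨i, h⟩)
          else Int.ofNat (t ⟨p + q - 1 - (i : ℕ), by have := i.isLt; omega⟩)
  have hpW : pW p q s t = gE p a := by
    funext x
    unfold pW gE gW
    congr 2
    ext i k
    simp only [Matrix.of_apply]
    congr 1
    funext y
    by_cases h : (i : ℕ) < p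
    · simp [a, h, gF]
    · simp [a, h, gF]
  have hai : Function.Injective a := by
    intro i j hij
    by_cases hi : (i : ℕ) < p <;> by_cases hj : (j : ℕ) < p <;> simp only [a, hi, hj, dif_pos,
      dif_neg, not_false_eq_true] at hij
    · have := hs.injective (Int.negSucc.inj hij)
      simp only [Fin.mk.injEq] at this
      exact Fin.ext this
    · cases hij
    · cases hij
    · have := ht.injective (Int.ofNat.inj hij)
      simp only [Fin.mk.injEq] at this
      apply Fin.ext
      have := i.isLt
      have := j.isLt
      omega
  let L : Finset ℤ := Finset.univ.image a
  have hL : ∀ m, m ∈ L ↔ ∃ i, a i = m := by intro m; simp [L]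
  have hneg : ∀ n : ℕ, Int.negSucc n ∈ L ↔ n ∈ Set.range s := by
    intro n
    rw [hL]
    constructor
    · rintro ⟨i, hi⟩
      by_cases h : (i : ℕ) < p
      · simp only [a, h, dif_pos] at hi
        exact ⟨_, Int.negSucc.inj hi⟩
      · simp only [a, h, dif_neg, not_false_eq_true] at hi
        cases hi
    · rintro ⟨i, rfl⟩
      exact ⟨Fin.castAdd q i, by simp [a]⟩
  have hpos : ∀ n : ℕ, Int.ofNat n ∈ L ↔ n ∈ Set.range t := by
    intro n
    rw [hL]
    constructor
    · rintro ⟨i, hi⟩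
      by_cases h : (i : ℕ) < p
      · simp only [a, h, dif_pos] at hi
        cases hi
      · simp only [a, h, dif_neg, not_false_eq_true] at hi
        exact ⟨_, Int.ofNat.inj hi⟩
    · rintro ⟨i, rfl⟩
      have hi := i.isLt
      refine ⟨⟨p + q - 1 - i, by omega⟩, ?_⟩
      have : ¬ (p + q - 1 - (i : ℕ) < p) := by omega
      simp only [a, this, dif_neg, not_false_eq_true]
      congr 2
      apply Fin.ext
      simp only
      omega
  have hNp : gN L = p := by
    have : L.filter (· < 0) = Finset.univ.image (fun i : Fin p => Int.negSucc (s i)) := by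
      ext m
      rw [Finset.mem_filter]
      cases m with
      | ofNat n => simp
      | negSucc n =>
        rw [hneg]
        simp [Int.negSucc_lt_zero]
    unfold gN
    rw [this, Finset.card_image_of_injective]
    · simp
    · intro i j hij
      exact hs.injective (Int.negSucc.inj hij)
  refine ⟨L, ?_, ?_, ?_, hNp, ?_⟩
  · intro m
    cases m with
    | ofNat n =>
      rw [hpos, hrt]
      simp [MayaPlus]
    | negSucc n =>
      rw [hneg, hrs]
      have : ¬ (0 ≤ Int.negSucc n) := by have := Int.negSucc_lt_zero n; omega
      have e : -(n : ℤ) - 1 = Int.negSucc n := by rw [Int.negSucc_eq]; ring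
      simp only [MayaMinus, Set.mem_ofPred_eq, e, this, false_iff]
  · have := gG_enum L a hai hL
    rw [hNp] at this
    rw [hpW]; exact this
  · rw [Finset.card_image_of_injective _ hai]; simp
  · rw [hpW]
    unfold gE gW
    refine Continuous.mul (by fun_prop) (Continuous.matrix_det ?_)
    refine continuous_matrix fun i k => ?_
    exact (contDiff_iter_aux (gF_contDiff (a i)) k).continuous

lemma log_aux {f g : ℝ → ℝ} (h : PropTo f g) (hg : Continuous g) (x : ℝ) (hx : g x ≠ 0) :
    iteratedDeriv 2 (fun y => Real.log (f y)) x = iteratedDeriv 2 (fun y => Real.log (g y)) x := by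
  obtain ⟨c, hc, h⟩ := h
  have e : (fun y => Real.log (f y)) =ᶠ[nhds x] fun y => Real.log c + Real.log (g y) := by
    filter_upwards [hg.continuousAt.eventually_ne hx] with y hy
    rw [h, Real.log_mul hc hy]
  rw [e.iteratedDeriv_eq 2, iteratedDeriv_const_add (by norm_num)]

lemma core_lemma (M M' : Set ℤ) (k : ℕ) (hM : M' = shiftM M (-k))
    {p q p' q' : ℕ} (s : Fin p → ℕ) (t : Fin q → ℕ)
    (s' : Fin p' → ℕ) (t' : Fin q' → ℕ)
    (hf : IsFrobenius M s t) (hf' : IsFrobenius M' s' t') :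
    PropTo (pW p' q' s' t') (pW p q s t) ∧ ((q' : ℤ) - (p' : ℤ) = (q : ℤ) - (p : ℤ) + k) := by
  subst hM
  obtain ⟨L, h1, h2, h3, h4, -⟩ := pW_enum s t hf
  obtain ⟨L', h1', h2', h3', h4', -⟩ := pW_enum s' t' hf'
  obtain ⟨h5, h6⟩ := step_many k L L' M h1 h1'
  refine ⟨h2'.trans (h5.trans h2.symm), ?_⟩
  rw [h3, h4, h3', h4'] at h6
  push_cast at h6
  linarith

/-- For `M' = M + k` (i.e. `M' = shiftM M (-k)`), the pseudo-Wronskians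
`H_{M'}` and `H_M` have the same zeros, the rational extension potentials
`U_M = x² − 2 (log H_M)″ + 2 #M₊ − 2 #M₋` satisfy `U_{M'} = U_M + 2k` wherever
`H_M ≠ 0`, `(log H_{M'})″ = (log H_M)″` wherever defined, and
`#M'₊ − #M'₋ = #M₊ − #M₋ + k`. -/
theorem rational_extension_shift (M : Set ℤ) (hM : IsMaya M) (k : ℤ)
    {p q p' q' : ℕ} (s : Fin p → ℕ) (t : Fin q → ℕ)
    (s' : Fin p' → ℕ) (t' : Fin q' → ℕ)
    (hf : IsFrobenius M s t) (hf' : IsFrobenius (shiftM M (-k)) s' t') :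
    (∀ x : ℝ, pW p' q' s' t' x = 0 ↔ pW p q s t x = 0) ∧
    (∀ x : ℝ, pW p q s t x ≠ 0 →
      x ^ 2 - 2 * iteratedDeriv 2 (fun y => Real.log (pW p' q' s' t' y)) x
          + 2 * (q' : ℝ) - 2 * (p' : ℝ)
        = (x ^ 2 - 2 * iteratedDeriv 2 (fun y => Real.log (pW p q s t y)) x
            + 2 * (q : ℝ) - 2 * (p : ℝ)) + 2 * (k : ℝ)) ∧
    (∀ x : ℝ, pW p q s t x ≠ 0 →
      iteratedDeriv 2 (fun y => Real.log (pW p' q' s' t' y)) x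
        = iteratedDeriv 2 (fun y => Real.log (pW p q s t y)) x) ∧
    ((q' : ℤ) - (p' : ℤ) = (q : ℤ) - (p : ℤ) + k) := by
  have key : PropTo (pW p' q' s' t') (pW p q s t) ∧
      ((q' : ℤ) - (p' : ℤ) = (q : ℤ) - (p : ℤ) + k) := by
    rcases Int.eq_nat_or_neg k with ⟨n, rfl | rfl⟩
    · exact core_lemma M _ n rfl s t s' t' hf hf'
    · have := core_lemma (shiftM M (- -(n : ℤ))) M n (by ext m; simp [shiftM]) s' t' s t hf' hf
      exact ⟨this.1.symm, by linarith [this.2]⟩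
  obtain ⟨hP, hq⟩ := key
  obtain ⟨-, -, -, -, -, hcont⟩ := pW_enum s t hf
  have hlog := log_aux hP hcont
  refine ⟨fun x => ?_, fun x hx => ?_, hlog, hq⟩
  · obtain ⟨c, hc, h⟩ := hP
    rw [h]; simp [hc]
  · rw [hlog x hx]
    have hq2 : (q' : ℝ) - p' = q - p + k := by exact_mod_cast hq
    linarith
end
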